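/- arXiv:1806.00519 — 3 statements merged into one kernel-verified Lean document; each statement's English description precedes it below -/
import Mathlib

section
/- Let x̂ ∈ X be a generalized mode of the Borel probability measure μ. Suppose that (i) for every sequence {δ_n} of positive reals with δ_n → 0 there exists a sequence {w_n} ⊂ X with w_n → x̂ in X, lim_{n→∞} μ(B^{δ_n}(w_n))/M^{δ_n} = 1 and lim_{n→∞} ‖w_n − x̂‖_X / δ_n = 0, and (ii) the family of functions f_n : [0,1] → ℝ defined by f_n(r) := μ(B^{r(δ_n + ‖w_n − x̂‖_X)}(x̂)) / μ(B^{δ_n + ‖w_n − x̂‖_X}(x̂)) is equicontinuous at r = 1. Then x̂ is a strong mode of μ. -/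
open MeasureTheory Metric Filter Topology

/-- The maximal probability of an open ball of radius `δ` under `μ`. -/
noncomputable def maxBallProb {X : Type*} [PseudoMetricSpace X] [MeasurableSpace X]
    (μ : Measure X) (δ : ℝ) : ℝ :=
  ⨆ x : X, (μ (ball x δ)).toReal

/-- `xhat` is a strong mode of `μ` if `μ(B^δ(xhat))/M^δ → 1` as `δ → 0⁺`. -/
def IsStrongMode {X : Type*} [PseudoMetricSpace X] [MeasurableSpace X]
    (μ : Measure X) (xhat : X) : Prop :=
  Tendsto (fun δ : ℝ => (μ (ball xhat δ)).toReal / maxBallProb μ δ) (𝓝[>] (0 : ℝ)) (𝓝 1)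

/-- `xhat` is a generalized mode of `μ` if for every positive sequence `δ_n → 0` there is an
approximating sequence `w_n → xhat` with `μ(B^{δ_n}(w_n))/M^{δ_n} → 1`. -/
def IsGeneralizedMode {X : Type*} [PseudoMetricSpace X] [MeasurableSpace X]
    (μ : Measure X) (xhat : X) : Prop :=
  ∀ δ : ℕ → ℝ, (∀ n, 0 < δ n) → Tendsto δ atTop (𝓝 (0 : ℝ)) →
    ∃ w : ℕ → X, Tendsto w atTop (𝓝 xhat) ∧
      Tendsto (fun n => (μ (ball (w n) (δ n))).toReal / maxBallProb μ (δ n)) atTop (𝓝 1)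


theorem maxBallProb_nonneg {X : Type*} [PseudoMetricSpace X] [MeasurableSpace X]
    (μ : Measure X) (δ : ℝ) : 0 ≤ maxBallProb μ δ :=
  Real.iSup_nonneg fun _ => ENNReal.toReal_nonneg

theorem toReal_ball_le_maxBallProb {X : Type*} [PseudoMetricSpace X] [MeasurableSpace X]
    (μ : Measure X) [IsFiniteMeasure μ] (x : X) (δ : ℝ) :
    (μ (ball x δ)).toReal ≤ maxBallProb μ δ :=
  le_ciSup (f := fun y => (μ (ball y δ)).toReal)
    ⟨(μ Set.univ).toReal, by
      rintro _ ⟨y, rfl⟩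
      exact measureReal_mono (Set.subset_univ _)⟩ x

theorem strongMode_of_rate_and_equicontinuity {X : Type*} [NormedAddCommGroup X]
    [NormedSpace ℝ X] [CompleteSpace X] [TopologicalSpace.SeparableSpace X]
    [MeasurableSpace X] [BorelSpace X]
    (μ : Measure X) [IsProbabilityMeasure μ] (xhat : X)
    (hgen : IsGeneralizedMode μ xhat)
    (h : ∀ δ : ℕ → ℝ, (∀ n, 0 < δ n) → Tendsto δ atTop (𝓝 (0 : ℝ)) →
      ∃ w : ℕ → X, Tendsto w atTop (𝓝 xhat) ∧
        Tendsto (fun n => (μ (ball (w n) (δ n))).toReal / maxBallProb μ (δ n)) atTop (𝓝 1) ∧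
        Tendsto (fun n => ‖w n - xhat‖ / δ n) atTop (𝓝 (0 : ℝ)) ∧
        EquicontinuousAt
          (fun n (r : Set.Icc (0 : ℝ) 1) =>
            (μ (ball xhat ((r : ℝ) * (δ n + ‖w n - xhat‖)))).toReal /
              (μ (ball xhat (δ n + ‖w n - xhat‖))).toReal)
          ⟨1, zero_le_one, le_refl 1⟩) :
    IsStrongMode μ xhat := by
  refine tendsto_of_seq_tendsto fun d hd => ?_
  rw [tendsto_nhdsWithin_iff] at hd
  obtain ⟨hd0, hdpos⟩ := hd
  let δ : ℕ → ℝ := fun n => if 0 < d n then d n else 1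
  have hδpos : ∀ n, 0 < δ n := fun n => by
    simp only [δ]
    split_ifs with hn
    exacts [hn, one_pos]
  have hδd : d =ᶠ[atTop] δ := by
    filter_upwards [hdpos] with n hn
    exact (if_pos hn).symm
  obtain ⟨w, -, hratio, hrate, hequi⟩ := h δ hδpos (hd0.congr' hδd)
  let s : ℕ → ℝ := fun n => δ n + ‖w n - xhat‖
  have hspos : ∀ n, 0 < s n := fun n => add_pos_of_pos_of_nonneg (hδpos n) (norm_nonneg _)
  have hδs : ∀ n, δ n ≤ s n := fun n => le_add_of_nonneg_right (norm_nonneg _)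
  let r : ℕ → Set.Icc (0 : ℝ) 1 := fun n =>
    ⟨δ n / s n, (div_pos (hδpos n) (hspos n)).le, (div_le_one (hspos n)).2 (hδs n)⟩
  have hr : Tendsto r atTop (𝓝 ⟨1, zero_le_one, le_refl 1⟩) := by
    rw [tendsto_subtype_rng]
    have h1 : Tendsto (fun n => (1 + ‖w n - xhat‖ / δ n)⁻¹) atTop (𝓝 1) := by
      simpa using (hrate.const_add 1).inv₀ (by norm_num)
    refine h1.congr fun n => ?_
    have := (hδpos n).ne'
    have := (hspos n).ne'
    simp only [r, s] at *
    field_simp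
  have hsub : ∀ n, ball (w n) (δ n) ⊆ ball xhat (s n) := fun n =>
    ball_subset_ball' (by rw [dist_eq_norm])
  have hmono : ∀ n, (μ (ball (w n) (δ n))).toReal ≤ (μ (ball xhat (s n))).toReal := fun n =>
    measureReal_mono (hsub n)
  have hbpos : ∀ᶠ n in atTop, 0 < (μ (ball (w n) (δ n))).toReal := by
    filter_upwards [hratio.eventually_ne one_ne_zero] with n hn
    refine lt_of_le_of_ne ENNReal.toReal_nonneg fun h0 => hn ?_
    rw [← h0, zero_div]
  let g : ℕ → ℝ := fun n => (μ (ball xhat (δ n))).toReal / (μ (ball xhat (s n))).toReal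
  have hg : Tendsto g atTop (𝓝 1) := by
    rw [Metric.tendsto_nhds]
    intro ε hε
    filter_upwards [hr.eventually (Metric.equicontinuousAt_iff_right.1 hequi ε hε), hbpos]
      with n hn hb
    have hn := hn n
    have hs : (μ (ball xhat (s n))).toReal ≠ 0 := (hb.trans_le (hmono n)).ne'
    simp only [r] at hn
    rw [one_mul, div_self hs, div_mul_cancel₀ _ (hspos n).ne', dist_comm] at hn
    exact hn
  have hlow := hg.mul hratio
  rw [one_mul] at hlow
  have hmain : Tendsto (fun n => (μ (ball xhat (δ n))).toReal / maxBallProb μ (δ n))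
      atTop (𝓝 1) := by
    refine tendsto_of_tendsto_of_tendsto_of_le_of_le' hlow tendsto_const_nhds ?_
      (Eventually.of_forall fun n => ?_)
    · filter_upwards [hbpos] with n hb
      have hs := hb.trans_le (hmono n)
      rw [← mul_div_assoc]
      refine div_le_div_of_nonneg_right ?_ (maxBallProb_nonneg μ _)
      calc g n * (μ (ball (w n) (δ n))).toReal
          ≤ g n * (μ (ball xhat (s n))).toReal :=
            mul_le_mul_of_nonneg_left (hmono n)
              (div_nonneg ENNReal.toReal_nonneg ENNReal.toReal_nonneg)
        _ = (μ (ball xhat (δ n))).toReal := div_mul_cancel₀ _ hs.ne'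
    · exact div_le_one_of_le₀ (toReal_ball_le_maxBallProb μ xhat _) (maxBallProb_nonneg μ _)
  refine hmain.congr' ?_
  filter_upwards [hδd] with n hn
  simp only [Function.comp_apply, hn]
end

section
/- Every point x̂ ∈ E_γ^0 is a strong mode of the uniform measure μ_γ. -/
open MeasureTheory Metric Filter Topology

/-- The space `c₀` of real sequences converging to zero, with the supremum norm,
realized as the zero-at-infinity continuous maps on `ℕ`. -/
abbrev CZero : Type := ZeroAtInftyContinuousMap ℕ ℝ

/-- The set `E_γ = {x : ∀ k, |x_k| ≤ γ_k}`. -/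
def Egamma (γ : ℕ → ℝ) : Set CZero := {x | ∀ k, |x k| ≤ γ k}

/-- The set `E_γ^δ = {x : ∀ k, |x_k| ≤ max (γ_k - δ) 0}`. -/
def EgammaD (γ : ℕ → ℝ) (δ : ℝ) : Set CZero := {x | ∀ k, |x k| ≤ max (γ k - δ) 0}

/-- The law `ν_k` of `γ_k ξ_k` where `ξ_k` is uniform on `[-1,1]`: the uniform distribution
on `[-γ_k, γ_k]` if `γ_k > 0`, and the Dirac measure at `0` if `γ_k = 0`. -/
noncomputable def nuMeas (γ : ℕ → ℝ) (k : ℕ) : Measure ℝ :=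
  if γ k = 0 then Measure.dirac 0
  else (ENNReal.ofReal (2 * γ k))⁻¹ • volume.restrict (Set.Icc (-(γ k)) (γ k))

/-- `μ` is the law on `c₀` of the random series `ξ = Σ γ_k ξ_k e_k` with `ξ_k` i.i.d. uniform
on `[-1,1]` (equivalently, the pushforward under `t ↦ (γ_k t_k)_k` of the countable product of
uniform measures on `[-1,1]`), characterized by its finite-dimensional marginals: the
coordinates are independent with `x_k ∼ ν_k`. -/
def IsUniformSeriesLaw (γ : ℕ → ℝ) {m : MeasurableSpace CZero} (μ : Measure CZero) : Prop :=
  ∀ (n : ℕ) (A : ℕ → Set ℝ), (∀ k, MeasurableSet (A k)) →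
    μ {x : CZero | ∀ k < n, x k ∈ A k} = ∏ k ∈ Finset.range n, nuMeas γ k (A k)

lemma CZero.mem_ball_iff {x y : CZero} {r : ℝ} (hr : 0 < r) :
    y ∈ ball x r ↔ ∀ k, y k ∈ ball (x k) r := by
  constructor
  · intro h k
    rw [mem_ball, ← ZeroAtInftyContinuousMap.dist_toBCF_eq_dist] at h
    exact (BoundedContinuousFunction.dist_coe_le_dist k).trans_lt h
  · intro h
    have hlim : Tendsto (fun k => dist (y k) (x k)) cofinite (𝓝 0) := by
      have hy := y.zero_at_infty'
      have hx := x.zero_at_infty'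
      rw [Filter.cocompact_eq_cofinite] at hx hy
      simpa using hy.dist hx
    have hfin : {k | ¬ dist (y k) (x k) < r / 2}.Finite :=
      hlim.eventually (gt_mem_nhds (half_pos hr))
    obtain ⟨C, hC0, hCr, hC⟩ : ∃ C, 0 ≤ C ∧ C < r ∧ ∀ k, dist (y k) (x k) ≤ C := by
      rcases Set.eq_empty_or_nonempty {k | ¬ dist (y k) (x k) < r / 2} with he | hne
      · refine ⟨r / 2, by positivity, by linarith, fun k => ?_⟩
        by_contra hk
        exact Set.eq_empty_iff_forall_notMem.1 he k fun h' => hk h'.le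
      · obtain ⟨k₀, hk₀, hmax⟩ :=
          Set.exists_max_image _ (fun k => dist (y k) (x k)) hfin hne
        refine ⟨dist (y k₀) (x k₀), dist_nonneg, h k₀, fun k => ?_⟩
        by_cases hk : dist (y k) (x k) < r / 2
        · exact hk.le.trans (not_lt.1 hk₀)
        · exact hmax k hk
    rw [mem_ball, ← ZeroAtInftyContinuousMap.dist_toBCF_eq_dist]
    exact ((BoundedContinuousFunction.dist_le hC0).2 hC).trans_lt hCr

lemma isProbabilityMeasure_nuMeas {γ : ℕ → ℝ} {k : ℕ} (hγ : 0 ≤ γ k) :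
    IsProbabilityMeasure (nuMeas γ k) := by
  unfold nuMeas
  split_ifs with h
  · infer_instance
  · have hpos : 0 < 2 * γ k := by positivity
    refine ⟨?_⟩
    rw [Measure.smul_apply, Measure.restrict_apply_univ, Real.volume_Icc, smul_eq_mul,
      sub_neg_eq_add, ← two_mul]
    exact ENNReal.inv_mul_cancel (by simpa using hpos) ENNReal.ofReal_ne_top

lemma nuMeas_ball_zero {γ : ℕ → ℝ} {k : ℕ} (hγ : 0 ≤ γ k) {r : ℝ} (hr : γ k < r) :
    nuMeas γ k (ball 0 r) = 1 := by
  have := isProbabilityMeasure_nuMeas hγ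
  rw [← prob_compl_eq_zero_iff measurableSet_ball]
  unfold nuMeas
  split_ifs with h
  · rw [Measure.dirac_apply' _ measurableSet_ball.compl]
    simp [h ▸ hr]
  · rw [Measure.smul_apply, Measure.restrict_apply measurableSet_ball.compl]
    have : (ball (0 : ℝ) r)ᶜ ∩ Set.Icc (-(γ k)) (γ k) = ∅ := by
      ext t
      simp only [Set.mem_inter_iff, Set.mem_compl_iff, mem_ball_zero_iff, Real.norm_eq_abs,
        ← abs_le, Set.mem_Icc, Set.mem_empty_iff_false, iff_false, not_and, not_le, not_lt]
      exact hr.trans_le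
    simp [this]

lemma nuMeas_ball_le {γ : ℕ → ℝ} {k : ℕ} (hγ : 0 < γ k) (x r : ℝ) :
    nuMeas γ k (ball x r) ≤ (ENNReal.ofReal (2 * γ k))⁻¹ * ENNReal.ofReal (2 * r) := by
  rw [nuMeas, if_neg hγ.ne', Measure.smul_apply, smul_eq_mul, ← Real.volume_ball x r]
  gcongr
  exact Measure.restrict_le_self

lemma nuMeas_ball_of_subset {γ : ℕ → ℝ} {k : ℕ} (hγ : 0 < γ k) {x r : ℝ}
    (hx : |x| + r ≤ γ k) :
    nuMeas γ k (ball x r) = (ENNReal.ofReal (2 * γ k))⁻¹ * ENNReal.ofReal (2 * r) := by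
  have hsub : ball x r ⊆ Set.Icc (-(γ k)) (γ k) := by
    rw [Real.ball_eq_Ioo]
    refine Set.Ioo_subset_Icc_self.trans (Set.Icc_subset_Icc ?_ ?_)
    · linarith [neg_abs_le x]
    · linarith [le_abs_self x]
  rw [nuMeas, if_neg hγ.ne', Measure.smul_apply, smul_eq_mul,
    Measure.restrict_apply measurableSet_ball, Set.inter_eq_self_of_subset_left hsub,
    Real.volume_ball]

lemma eq_zero_of_abs_le_max {x a : ℝ} (ha : a ≤ 0) (hx : |x| ≤ max a 0) : x = 0 := by
  rw [max_eq_right ha] at hx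
  exact abs_nonpos_iff.1 hx

lemma nuMeas_ball_le_of_abs_le {γ : ℕ → ℝ} {k : ℕ} (hγ : 0 ≤ γ k) {δ r x : ℝ} (hr : 0 < r)
    (hrδ : r ≤ δ) (hx : |x| ≤ max (γ k - δ) 0) (y : ℝ) :
    nuMeas γ k (ball y r) ≤ nuMeas γ k (ball x r) := by
  rcases lt_or_ge (γ k) r with h | h
  · have := isProbabilityMeasure_nuMeas hγ
    rw [eq_zero_of_abs_le_max (by linarith) hx, nuMeas_ball_zero hγ h]
    exact prob_le_one
  · have hpos : 0 < γ k := hr.trans_le h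
    rw [nuMeas_ball_of_subset hpos (x := x)]
    · exact nuMeas_ball_le hpos y r
    · rcases le_max_iff.1 hx with h' | h' <;> linarith

lemma nuMeas_ball_ne_zero {γ : ℕ → ℝ} {k : ℕ} (hγ : 0 ≤ γ k) {δ r x : ℝ} (hr : 0 < r)
    (hrδ : r ≤ δ) (hx : |x| ≤ max (γ k - δ) 0) :
    nuMeas γ k (ball x r) ≠ 0 := by
  rcases lt_or_ge (γ k) r with h | h
  · rw [eq_zero_of_abs_le_max (by linarith) hx, nuMeas_ball_zero hγ h]
    exact one_ne_zero
  · have hpos : 0 < γ k := hr.trans_le h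
    rw [nuMeas_ball_of_subset hpos]
    · exact mul_ne_zero (ENNReal.inv_ne_zero.2 ENNReal.ofReal_ne_top) (by simpa using hr)
    · rcases le_max_iff.1 hx with h' | h' <;> linarith

section BallProbability

variable [MeasurableSpace CZero] {μ : Measure CZero} {γ : ℕ → ℝ}

lemma IsUniformSeriesLaw.measure_ball_le_prod (hμ : IsUniformSeriesLaw γ μ) (x : CZero) {r : ℝ}
    (hr : 0 < r) (n : ℕ) :
    μ (ball x r) ≤ ∏ k ∈ Finset.range n, nuMeas γ k (ball (x k) r) := by
  rw [← hμ n (fun k => ball (x k) r) fun _ => measurableSet_ball]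
  exact measure_mono fun y hy k _ => (CZero.mem_ball_iff hr).1 hy k

lemma IsUniformSeriesLaw.tendsto_prod_measure_ball [BorelSpace CZero] [IsFiniteMeasure μ]
    (hμ : IsUniformSeriesLaw γ μ) (x : CZero) {r : ℝ} (hr : 0 < r) :
    Tendsto (fun n => ∏ k ∈ Finset.range n, nuMeas γ k (ball (x k) r)) atTop
      (𝓝 (μ (ball x r))) := by
  have hball : ball x r = ⋂ n : ℕ, {y : CZero | ∀ k < n, y k ∈ ball (x k) r} := by
    ext y
    simp only [CZero.mem_ball_iff hr, Set.mem_iInter, Set.mem_ofPred_eq]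
    exact ⟨fun h _ k _ => h k, fun h k => h (k + 1) k k.lt_succ_self⟩
  have hcont (k : ℕ) : Continuous fun y : CZero => y k :=
    (continuous_eval_const (F := BoundedContinuousFunction ℕ ℝ) k).comp
      ZeroAtInftyContinuousMap.isometry_toBCF.continuous
  rw [hball]
  simp_rw [← hμ _ (fun k => ball (x k) r) fun _ => measurableSet_ball]
  refine tendsto_measure_iInter_atTop (fun n => ?_) ?_ ⟨0, measure_ne_top _ _⟩
  · refine MeasurableSet.nullMeasurableSet ?_
    simp only [Set.ofPred_forall]
    exact .iInter fun k => .iInter fun _ => (isOpen_ball.preimage (hcont k)).measurableSet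
  · exact fun m n hmn y hy k hk => hy k (hk.trans_le hmn)

variable [BorelSpace CZero] [IsFiniteMeasure μ] {x : CZero} {δ r : ℝ}

lemma IsUniformSeriesLaw.measure_ball_le (hμ : IsUniformSeriesLaw γ μ) (hγ0 : ∀ k, 0 ≤ γ k)
    (hx : x ∈ EgammaD γ δ) (hr : 0 < r) (hrδ : r ≤ δ) (y : CZero) :
    μ (ball y r) ≤ μ (ball x r) :=
  ge_of_tendsto' (hμ.tendsto_prod_measure_ball x hr) fun n =>
    (hμ.measure_ball_le_prod y hr n).trans <| Finset.prod_le_prod' fun k _ =>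
      nuMeas_ball_le_of_abs_le (hγ0 k) hr hrδ (hx k) (y k)

lemma IsUniformSeriesLaw.measure_ball_ne_zero (hμ : IsUniformSeriesLaw γ μ)
    (hγ0 : ∀ k, 0 ≤ γ k) (hγ : Tendsto γ atTop (𝓝 0))
    (hx : x ∈ EgammaD γ δ) (hr : 0 < r) (hrδ : r ≤ δ) :
    μ (ball x r) ≠ 0 := by
  obtain ⟨N, hN⟩ := eventually_atTop.1 (hγ.eventually (gt_mem_nhds hr))
  have hconst : ∀ n ≥ N, ∏ k ∈ Finset.range N, nuMeas γ k (ball (x k) r) =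
      ∏ k ∈ Finset.range n, nuMeas γ k (ball (x k) r) := fun n hn =>
    Finset.prod_subset (Finset.range_mono hn) fun k _ hk => by
      have hkr : γ k < r := hN k (by simpa using hk)
      rw [eq_zero_of_abs_le_max (by linarith) (hx k), nuMeas_ball_zero (hγ0 k) hkr]
  have hlim := tendsto_nhds_unique (hμ.tendsto_prod_measure_ball x hr)
    (tendsto_atTop_of_eventually_const fun n hn => (hconst n hn).symm)
  rw [hlim]
  exact Finset.prod_ne_zero_iff.2 fun k _ => nuMeas_ball_ne_zero (hγ0 k) hr hrδ (hx k)

end BallProbability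

theorem strongMode_of_mem_EgammaZero (γ : ℕ → ℝ) (hγ0 : ∀ k, 0 ≤ γ k)
    (hγ : Tendsto γ atTop (𝓝 (0 : ℝ)))
    [MeasurableSpace CZero] [BorelSpace CZero]
    (μ : Measure CZero) [IsProbabilityMeasure μ] (hμ : IsUniformSeriesLaw γ μ)
    (xhat : CZero) (hxhat : xhat ∈ ⋃ δ > (0 : ℝ), EgammaD γ δ) :
    IsStrongMode μ xhat := by
  simp only [Set.mem_iUnion] at hxhat
  obtain ⟨δ, hδ, hx⟩ := hxhat
  refine tendsto_const_nhds.congr' ?_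
  filter_upwards [Ioc_mem_nhdsGT hδ] with r hr
  have hle (y : CZero) : (μ (ball y r)).toReal ≤ (μ (ball xhat r)).toReal :=
    ENNReal.toReal_mono (measure_ne_top _ _) (hμ.measure_ball_le hγ0 hx hr.1 hr.2 y)
  have hmax : maxBallProb μ r = (μ (ball xhat r)).toReal :=
    le_antisymm (ciSup_le hle) (le_ciSup (f := fun y => (μ (ball y r)).toReal)
      ⟨_, Set.forall_mem_range.2 hle⟩ xhat)
  rw [hmax, div_self]
  exact ENNReal.toReal_ne_zero.2
    ⟨hμ.measure_ball_ne_zero hγ0 hγ hx hr.1 hr.2, measure_ne_top _ _⟩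
end

section
/- Let x₁, x₂ ∈ E_γ and let {w₁^δ}_{δ>0}, {w₂^δ}_{δ>0} ⊂ X be families with w₁^δ, w₂^δ ∈ E_γ^δ for all δ > 0 and w₁^δ → x₁, w₂^δ → x₂ in X as δ → 0. Then lim_{δ→0} J^δ(w₁^δ)/J^δ(w₂^δ) = exp(Φ(x₂) − Φ(x₁)). -/
open MeasureTheory Metric Filter Topology

/-- The normalization constant `Z = ∫ exp(-Φ(x)) dμ(x)`. -/
noncomputable def normConst {m : MeasurableSpace CZero} (μ : Measure CZero)
    (Φ : CZero → ℝ) : ENNReal :=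
  ∫⁻ x, ENNReal.ofReal (Real.exp (-Φ x)) ∂μ

/-- The posterior measure `μ^y(A) = Z⁻¹ ∫_A exp(-Φ(x)) dμ(x)`. -/
noncomputable def posterior {m : MeasurableSpace CZero} (μ : Measure CZero)
    (Φ : CZero → ℝ) : Measure CZero :=
  (normConst μ Φ)⁻¹ • μ.withDensity (fun x => ENNReal.ofReal (Real.exp (-Φ x)))

/-- `Φ` is Lipschitz continuous on every bounded subset of `c₀`. -/
def LipschitzOnBounded (Φ : CZero → ℝ) : Prop :=
  ∀ r : ℝ, 0 < r → ∃ L : ℝ, ∀ x₁ x₂ : CZero, ‖x₁‖ ≤ r → ‖x₂‖ ≤ r →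
    |Φ x₁ - Φ x₂| ≤ L * ‖x₁ - x₂‖

/-- The mass which the `k`-th coordinate law gives to an interval of radius `δ` does not depend
on its centre, as long as the centre is at distance at least `δ` from the endpoints `±γ_k`. -/
lemma nuMeas_Ioo {γ : ℕ → ℝ} {k : ℕ} (hγ0 : 0 ≤ γ k) {δ : ℝ} (hδ : 0 < δ) {a : ℝ}
    (ha : |a| ≤ max (γ k - δ) 0) :
    nuMeas γ k (Set.Ioo (a - δ) (a + δ)) = if γ k < δ then 1 else ENNReal.ofReal (δ / γ k) := by
  split_ifs with h
  · rw [max_eq_right (by linarith), abs_nonpos_iff] at ha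
    subst ha
    unfold nuMeas
    split_ifs with h0
    · rw [Measure.dirac_apply' _ measurableSet_Ioo]
      simp [hδ]
    · have hpos : 0 < γ k := lt_of_le_of_ne hγ0 (Ne.symm h0)
      rw [Measure.smul_apply, Measure.restrict_apply measurableSet_Ioo,
        Set.inter_eq_right.2 (Set.Icc_subset_Ioo (by linarith) (by linarith)),
        Real.volume_Icc, sub_neg_eq_add, ← two_mul, smul_eq_mul]
      exact ENNReal.inv_mul_cancel (ENNReal.ofReal_pos.2 (by linarith)).ne' ENNReal.ofReal_ne_top
  · push Not at h
    have hpos : 0 < γ k := hδ.trans_le h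
    rw [max_eq_left (by linarith), abs_le] at ha
    rw [nuMeas, if_neg hpos.ne', Measure.smul_apply, Measure.restrict_apply measurableSet_Ioo,
      Set.inter_eq_left.2 (Set.Ioo_subset_Icc_self.trans
        (Set.Icc_subset_Icc (by linarith) (by linarith))),
      Real.volume_Ioo, smul_eq_mul, ← ENNReal.ofReal_inv_of_pos (by linarith),
      ← ENNReal.ofReal_mul (by positivity)]
    congr 1
    field_simp
    ring

/-- A ball of `c₀` is a countable intersection of coordinate strips. -/
lemma CZero.ball_eq_iInter (w : CZero) {δ : ℝ} (hδ : 0 < δ) :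
    ball w δ = ⋂ n : ℕ, {x : CZero | ∀ k < n, x k ∈ Set.Ioo (w k - δ) (w k + δ)} := by
  have dist_coord_le (x : CZero) (k : ℕ) : |x k - w k| ≤ dist x w := by
    rw [← ZeroAtInftyContinuousMap.dist_toBCF_eq_dist, ← Real.dist_eq]
    exact BoundedContinuousFunction.dist_coe_le_dist (f := x.toBCF) (g := w.toBCF) k
  ext x
  simp only [mem_ball, Set.mem_iInter, Set.mem_ofPred_eq]
  constructor
  · intro h n k _
    have := abs_lt.1 ((dist_coord_le x k).trans_lt h)
    exact ⟨by linarith, by linarith⟩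
  · intro h
    have hlt (k : ℕ) : |x k - w k| < δ := by
      have := h (k + 1) k (Nat.lt_succ_self k)
      exact abs_lt.2 ⟨by linarith [this.1], by linarith [this.2]⟩
    have hzero : Tendsto (fun k => |x k - w k|) atTop (𝓝 0) := by
      have := (x - w).zero_at_infty'
      rw [cocompact_eq_cofinite, Nat.cofinite_eq_atTop] at this
      simpa using this.abs
    obtain ⟨N, hN⟩ := eventually_atTop.1 (hzero.eventually (gt_mem_nhds (half_pos hδ)))
    obtain ⟨c, hcδ, hc⟩ : ∃ c < δ, ∀ k < N, |x k - w k| ≤ c := by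
      clear hN
      induction N with
      | zero => exact ⟨0, hδ, by simp⟩
      | succ N ih =>
        obtain ⟨c, hc, hcN⟩ := ih
        refine ⟨max c |x N - w N|, max_lt hc (hlt N), fun k hk => ?_⟩
        rcases Nat.lt_succ_iff_lt_or_eq.1 hk with hk | rfl
        · exact (hcN k hk).trans (le_max_left _ _)
        · exact le_max_right _ _
    have hle (k : ℕ) : |x k - w k| ≤ max c (δ / 2) := by
      rcases lt_or_ge k N with hk | hk
      · exact (hc k hk).trans (le_max_left _ _)
      · exact (hN k hk).le.trans (le_max_right _ _)
    rw [← ZeroAtInftyContinuousMap.dist_toBCF_eq_dist]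
    refine lt_of_le_of_lt ((BoundedContinuousFunction.dist_le
      (le_max_of_le_right (half_pos hδ).le)).2 fun k => ?_) (max_lt hcδ (half_lt_self hδ))
    simpa [Real.dist_eq] using hle k

lemma CZero.continuous_eval (k : ℕ) : Continuous fun x : CZero => x k :=
  (continuous_eval_const (F := BoundedContinuousFunction ℕ ℝ) k).comp
    ZeroAtInftyContinuousMap.isometry_toBCF.continuous

/-- The prior mass of a `δ`-ball centred in `E_γ^δ`, as a finite product. -/
lemma measure_ball_of_mem_EgammaD {γ : ℕ → ℝ} (hγ0 : ∀ k, 0 ≤ γ k)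
    [MeasurableSpace CZero] [BorelSpace CZero] {μ : Measure CZero} [IsFiniteMeasure μ]
    (hμ : IsUniformSeriesLaw γ μ) {δ : ℝ} (hδ : 0 < δ) {N : ℕ} (hN : ∀ k ≥ N, γ k < δ)
    {w : CZero} (hw : w ∈ EgammaD γ δ) :
    μ (ball w δ) =
      ∏ k ∈ Finset.range N, if γ k < δ then 1 else ENNReal.ofReal (δ / γ k) := by
  set s : ℕ → Set CZero := fun n => {x | ∀ k < n, x k ∈ Set.Ioo (w k - δ) (w k + δ)} with hs
  have hmeas (n : ℕ) : MeasurableSet (s n) := by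
    have : s n = ⋂ k, ⋂ _ : k < n, (fun x : CZero => x k) ⁻¹' Set.Ioo (w k - δ) (w k + δ) := by
      ext x; simp [hs]
    rw [this]
    exact .iInter fun k => .iInter fun _ =>
      (CZero.continuous_eval k).measurable measurableSet_Ioo
  have hanti : Antitone s := fun m n hmn x hx k hk => hx k (hk.trans_le hmn)
  have hlim := tendsto_measure_iInter_atTop (μ := μ) (fun n => (hmeas n).nullMeasurableSet) hanti
    ⟨0, measure_ne_top μ _⟩
  rw [← CZero.ball_eq_iInter w hδ] at hlim
  refine tendsto_nhds_unique hlim (tendsto_const_nhds.congr' ?_)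
  filter_upwards [eventually_ge_atTop N] with n hn
  rw [Function.comp_apply, hs, hμ n _ fun _ => measurableSet_Ioo,
    Finset.prod_congr rfl fun k _ => nuMeas_Ioo (hγ0 k) hδ (hw k)]
  refine Finset.prod_subset (Finset.range_mono hn) fun k _ hk => if_pos (hN k ?_)
  simpa using hk

/-- Averages of a function over sets shrinking to a point of continuity converge to its value. -/
lemma tendsto_withDensity_div_measure {X ι : Type*} [TopologicalSpace X] [MeasurableSpace X]
    {μ : Measure X} {f : X → ENNReal} {x : X} (hf : ContinuousAt f x) {l : Filter ι}
    {s : ι → Set X} (hs : Tendsto s l (𝓝 x).smallSets) (hmeas : ∀ i, MeasurableSet (s i))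
    (h0 : ∀ᶠ i in l, μ (s i) ≠ 0) (htop : ∀ᶠ i in l, μ (s i) ≠ ⊤) :
    Tendsto (fun i => μ.withDensity f (s i) / μ (s i)) l (𝓝 (f x)) := by
  refine tendsto_order.2 ⟨fun a ha => ?_, fun a ha => ?_⟩
  · obtain ⟨b, hab, hb⟩ := exists_between ha
    filter_upwards [tendsto_smallSets_iff.1 hs _ (hf.eventually (lt_mem_nhds hb)), h0, htop]
      with i hi hi0 hit
    refine hab.trans_le ((ENNReal.le_div_iff_mul_le (.inl hi0) (.inl hit)).2 ?_)
    rw [withDensity_apply _ (hmeas i), ← setLIntegral_const]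
    exact setLIntegral_mono' (hmeas i) fun y hy => (hi hy).le
  · obtain ⟨b, hb, hba⟩ := exists_between ha
    filter_upwards [tendsto_smallSets_iff.1 hs _ (hf.eventually (gt_mem_nhds hb)), h0, htop]
      with i hi hi0 hit
    refine lt_of_le_of_lt ((ENNReal.div_le_iff_le_mul (.inl hi0) (.inl hit)).2 ?_) hba
    rw [withDensity_apply _ (hmeas i), ← setLIntegral_const]
    exact setLIntegral_mono' (hmeas i) fun y hy => (hi hy).le

lemma tendsto_ball_smallSets {X : Type*} [PseudoMetricSpace X] {w : ℝ → X} {x : X}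
    (hw : Tendsto w (𝓝[>] 0) (𝓝 x)) :
    Tendsto (fun δ => ball (w δ) δ) (𝓝[>] 0) (𝓝 x).smallSets := by
  refine tendsto_smallSets_iff.2 fun t ht => ?_
  obtain ⟨ε, hε, hεt⟩ := Metric.mem_nhds_iff.1 ht
  filter_upwards [hw.eventually (ball_mem_nhds x (half_pos hε)),
    mem_nhdsWithin_of_mem_nhds (gt_mem_nhds (half_pos hε))] with δ hδ hδε
  refine (ball_subset_ball' ?_).trans hεt
  linarith [mem_ball.1 hδ, show δ < ε / 2 from hδε]

lemma LipschitzOnBounded.continuous {Φ : CZero → ℝ} (hΦ : LipschitzOnBounded Φ) :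
    Continuous Φ := by
  refine continuous_iff_continuousAt.2 fun x => ?_
  obtain ⟨L, hL⟩ := hΦ (‖x‖ + 1) (by positivity)
  have hlim : Tendsto (fun y => L * ‖y - x‖) (𝓝 x) (𝓝 0) := by
    have : Continuous fun y : CZero => L * ‖y - x‖ := by fun_prop
    simpa using this.tendsto x
  refine tendsto_iff_dist_tendsto_zero.2
    (squeeze_zero' (.of_forall fun _ => dist_nonneg) ?_ hlim)
  filter_upwards [ball_mem_nhds x one_pos] with y hy
  refine hL y x ?_ (by linarith)
  have := norm_le_norm_add_norm_sub' y x
  rw [mem_ball, dist_eq_norm] at hy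
  linarith

theorem posterior_ball_ratio_limit (γ : ℕ → ℝ) (hγ0 : ∀ k, 0 ≤ γ k)
    (hγ : Tendsto γ atTop (𝓝 (0 : ℝ)))
    [MeasurableSpace CZero] [BorelSpace CZero]
    (μ : Measure CZero) [IsProbabilityMeasure μ] (hμ : IsUniformSeriesLaw γ μ)
    (Φ : CZero → ℝ) (hΦ : LipschitzOnBounded Φ)
    (hZ0 : normConst μ Φ ≠ 0) (hZtop : normConst μ Φ ≠ ⊤)
    (x₁ : CZero) (hx₁ : x₁ ∈ Egamma γ) (x₂ : CZero) (hx₂ : x₂ ∈ Egamma γ)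
    (w₁ w₂ : ℝ → CZero)
    (hw₁mem : ∀ δ : ℝ, 0 < δ → w₁ δ ∈ EgammaD γ δ)
    (hw₂mem : ∀ δ : ℝ, 0 < δ → w₂ δ ∈ EgammaD γ δ)
    (hw₁lim : Tendsto w₁ (𝓝[>] (0 : ℝ)) (𝓝 x₁))
    (hw₂lim : Tendsto w₂ (𝓝[>] (0 : ℝ)) (𝓝 x₂)) :
    Tendsto (fun δ : ℝ =>
        ((posterior μ Φ) (ball (w₁ δ) δ)).toReal / ((posterior μ Φ) (ball (w₂ δ) δ)).toReal)
      (𝓝[>] (0 : ℝ)) (𝓝 (Real.exp (Φ x₂ - Φ x₁))) := by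
  set f : CZero → ENNReal := fun x => ENNReal.ofReal (Real.exp (-Φ x)) with hf_def
  have hf : Continuous f := ENNReal.continuous_ofReal.comp
    (Real.continuous_exp.comp hΦ.continuous.neg)
  have hball : ∀ δ : ℝ, 0 < δ → ∃ c : ENNReal, c ≠ 0 ∧ ∀ w ∈ EgammaD γ δ, μ (ball w δ) = c := by
    intro δ hδ
    obtain ⟨N, hN⟩ := eventually_atTop.1 (hγ.eventually (gt_mem_nhds hδ))
    refine ⟨_, ?_, fun w hw => measure_ball_of_mem_EgammaD hγ0 hμ hδ hN hw⟩
    refine Finset.prod_ne_zero_iff.2 fun k _ => ?_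
    split_ifs with h
    · exact one_ne_zero
    · exact (ENNReal.ofReal_pos.2 (div_pos hδ (hδ.trans_le (not_lt.1 h)))).ne'
  have hlim {w : ℝ → CZero} {x : CZero} (hwmem : ∀ δ : ℝ, 0 < δ → w δ ∈ EgammaD γ δ)
      (hw : Tendsto w (𝓝[>] (0 : ℝ)) (𝓝 x)) :
      Tendsto (fun δ => (μ.withDensity f (ball (w δ) δ)).toReal / (μ (ball (w δ) δ)).toReal)
        (𝓝[>] (0 : ℝ)) (𝓝 (Real.exp (-Φ x))) := by
    have h0 : ∀ᶠ δ in 𝓝[>] (0 : ℝ), μ (ball (w δ) δ) ≠ 0 := by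
      filter_upwards [self_mem_nhdsWithin] with δ hδ
      obtain ⟨c, hc, hcw⟩ := hball δ hδ
      rwa [hcw _ (hwmem δ hδ)]
    have := tendsto_withDensity_div_measure hf.continuousAt (tendsto_ball_smallSets hw)
      (fun δ => measurableSet_ball) h0 (.of_forall fun δ => measure_ne_top μ _)
    simpa [hf_def, Function.comp_def, ENNReal.toReal_div, (Real.exp_pos _).le] using
      (ENNReal.tendsto_toReal (by simp [hf_def])).comp this
  have key := (hlim hw₁mem hw₁lim).div (hlim hw₂mem hw₂lim) (Real.exp_pos _).ne'
  rw [← Real.exp_sub, show -Φ x₁ - -Φ x₂ = Φ x₂ - Φ x₁ by ring] at key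
  refine key.congr' ?_
  filter_upwards [self_mem_nhdsWithin] with δ hδ
  obtain ⟨c, hc, hcw⟩ := hball δ hδ
  have hctop : c ≠ ⊤ := hcw _ (hw₁mem δ hδ) ▸ measure_ne_top μ _
  have hZ : ((normConst μ Φ)⁻¹).toReal ≠ 0 :=
    ENNReal.toReal_ne_zero.2 ⟨ENNReal.inv_ne_zero.2 hZtop, ENNReal.inv_ne_top.2 hZ0⟩
  rw [Pi.div_apply, hcw _ (hw₁mem δ hδ), hcw _ (hw₂mem δ hδ),
    div_div_div_cancel_right₀ (ENNReal.toReal_ne_zero.2 ⟨hc, hctop⟩)]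
  simp only [posterior, Measure.smul_apply, smul_eq_mul, ENNReal.toReal_mul]
  rw [mul_div_mul_left _ _ hZ]
end
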